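/- Antisymmetrization identity: for variables w_1,...,w_k and a parameter q, the antisymmetrization (1/k!)·Σ_{σ∈S_k} sign(σ)·Π_{i<j} (q·w_{σ(i)} − q^{−1}·w_{σ(j)}) equals ([k]!/k!)·Π_{i<j} (w_i − w_j), where [k] = (q^k − q^{−k})/(q − q^{−1}) and [k]! = [k][k−1]···[1]. -/

import Mathlib

open Finset

/-- The quantum integer `[k] = q^{k-1} + q^{k-3} + ⋯ + q^{-k+1}`. -/
noncomputable def qInt {F : Type*} [Field F] (q : F) (k : ℕ) : F :=
  ∑ j ∈ Finset.range k, q ^ ((k : ℤ) - 1 - 2 * (j : ℤ))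

/-- The quantum factorial `[k]! = [k][k-1]⋯[1]`. -/
noncomputable def qFact {F : Type*} [Field F] (q : F) (k : ℕ) : F :=
  ∏ j ∈ Finset.Icc 1 k, qInt q j

open Polynomial in
/-- The polynomial interpolating `∏_{j ≠ m} (q w_m - q⁻¹ w_j)` at the nodes `w_m`. -/
theorem exists_interp {F ι : Type*} [Field F] [DecidableEq ι] (q : F) (hq : q ≠ 0)
    (w : ι → F) (s : Finset ι) :
    ∃ T : F[X], (∀ m, s.card ≤ m → T.coeff m = 0) ∧ (X * T).coeff s.card = qInt q s.card ∧
      ∀ m ∈ s, T.eval (w m) = ∏ j ∈ s.erase m, (q * w m - q⁻¹ * w j) := by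
  induction s using Finset.induction_on with
  | empty => exact ⟨0, by simp, by simp [qInt], by simp⟩
  | insert e s he ih =>
    obtain ⟨T, h1, h2, h3⟩ := ih
    have hdeg : ∀ j ∈ s, (C q * X - C (q⁻¹ * w j)).natDegree ≤ 1 := fun j _ => by
      compute_degree
    have hP0 : ∀ m, s.card < m → (∏ j ∈ s, (C q * X - C (q⁻¹ * w j))).coeff m = 0 := by
      intro m hm
      apply coeff_eq_zero_of_natDegree_lt
      refine lt_of_le_of_lt (natDegree_prod_le _ _) ?_
      refine lt_of_le_of_lt (Finset.sum_le_card_nsmul _ _ 1 hdeg) ?_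
      simpa using hm
    have hP1 : (∏ j ∈ s, (C q * X - C (q⁻¹ * w j))).coeff s.card = q ^ s.card := by
      have := coeff_prod_of_natDegree_le s (fun j => C q * X - C (q⁻¹ * w j)) 1 hdeg
      simp only [mul_one] at this
      rw [this]
      simp [coeff_C]
    refine ⟨C q⁻¹ * (X * T - C (w e) * T) + ∏ j ∈ s, (C q * X - C (q⁻¹ * w j)), ?_, ?_, ?_⟩
    · intro m hm
      rw [Finset.card_insert_of_notMem he] at hm
      obtain ⟨l, rfl⟩ : ∃ l, m = l + 1 := ⟨m - 1, by omega⟩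
      rw [coeff_add, hP0 _ (by omega), coeff_C_mul, coeff_sub, coeff_X_mul, coeff_C_mul,
        h1 l (by omega), h1 (l + 1) (by omega)]
      simp
    · rw [Finset.card_insert_of_notMem he, coeff_X_mul, coeff_add, hP1, coeff_C_mul, coeff_sub,
        h2, coeff_C_mul, h1 _ le_rfl, qInt, qInt, Finset.sum_range_succ', mul_zero, sub_zero,
        Finset.mul_sum]
      congr 1
      · apply Finset.sum_congr rfl
        intro j _
        rw [← zpow_neg_one, ← zpow_add₀ hq]
        congr 1
        push_cast
        ring
      · rw [← zpow_natCast]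
        congr 1
        push_cast
        ring
    · intro m hm
      simp only [eval_add, eval_mul, eval_sub, eval_C, eval_X, eval_prod]
      rw [Finset.mem_insert] at hm
      rcases hm with rfl | hm
      · rw [Finset.erase_insert he]
        ring
      · have hne : e ≠ m := fun h => he (h ▸ hm)
        rw [h3 m hm, Finset.erase_insert_of_ne hne, Finset.prod_insert (by simp [he]),
          ← Finset.mul_prod_erase s _ hm]
        ring

theorem sum_qInt {F ι : Type*} [Field F] [DecidableEq ι] (q : F) (hq : q ≠ 0)
    (w : ι → F) (s : Finset ι) (hs : s.Nonempty) (hw : Set.InjOn w s) :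
    ∑ m ∈ s, (∏ j ∈ s.erase m, (q * w m - q⁻¹ * w j)) / ∏ j ∈ s.erase m, (w m - w j)
      = qInt q s.card := by
  obtain ⟨T, h1, h2, h3⟩ := exists_interp q hq w s
  have hd : T.degree < s.card := (Polynomial.degree_lt_iff_coeff_zero _ _).2 h1
  have := Lagrange.coeff_eq_sum hw hd
  obtain ⟨l, hl⟩ : ∃ l, s.card = l + 1 := ⟨s.card - 1, by have := hs.card_pos; omega⟩
  rw [← h2, hl, Polynomial.coeff_X_mul]
  rw [hl, Nat.add_sub_cancel] at this
  rw [this]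
  exact Finset.sum_congr rfl fun m hm => by rw [h3 m hm]

theorem prod_pairs {M : Type*} [CommMonoid M] (k : ℕ) (f : Fin k → Fin k → M) :
    ∏ p ∈ Finset.univ.filter (fun p : Fin k × Fin k => p.1 < p.2), f p.1 p.2 =
      ∏ i, ∏ j ∈ Finset.Ioi i, f i j :=
  Finset.prod_finset_product' _ _ _ (by simp)

theorem prod_pairs_succ {M : Type*} [CommMonoid M] (k : ℕ) (f : Fin (k + 1) → Fin (k + 1) → M) :
    ∏ i, ∏ j ∈ Finset.Ioi i, f i j =
      (∏ x : Fin k, f 0 x.succ) * ∏ i : Fin k, ∏ j ∈ Finset.Ioi i, f i.succ j.succ := by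
  rw [Fin.prod_univ_succ, Fin.prod_Ioi_zero]
  simp only [Fin.prod_Ioi_succ]

theorem prod_swap_succ {M : Type*} [CommMonoid M] (k : ℕ) (p : Fin (k + 1))
    (f : Fin (k + 1) → M) :
    ∏ x : Fin k, f (Equiv.swap 0 p x.succ) = ∏ j ∈ Finset.univ.erase p, f j := by
  have : Finset.univ.erase p =
      Finset.univ.map ((Fin.succEmb k).trans (Equiv.swap 0 p).toEmbedding) := by
    ext j
    simp only [Finset.mem_erase, Finset.mem_univ, and_true, Finset.mem_map, true_and]
    constructor
    · intro hj
      have : Equiv.swap 0 p j ≠ 0 := fun h => hj (by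
        rw [Equiv.swap_apply_eq_iff] at h
        simpa using h)
      obtain ⟨x, hx⟩ := Fin.exists_succ_eq.2 this
      exact ⟨x, by simp [hx]⟩
    · rintro ⟨x, rfl⟩ h
      have h' : Equiv.swap 0 p x.succ = p := h
      rw [Equiv.swap_apply_eq_iff] at h'
      simp at h'
  rw [this, Finset.prod_map]
  rfl

theorem sum_noninj {F : Type*} [Field F] [CharZero F] (k : ℕ) (w : Fin k → F)
    (hw : ¬ Function.Injective w) (G : (Fin k → F) → F) :
    ∑ σ : Equiv.Perm (Fin k), ((Equiv.Perm.sign σ : ℤ) : F) * G (w ∘ σ) = 0 := by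
  simp only [Function.Injective, not_forall] at hw
  obtain ⟨a, b, hab, hne⟩ := hw
  have hs : w ∘ Equiv.swap a b = w := by
    ext x
    simp only [Function.comp]
    rw [Equiv.swap_apply_def]
    split_ifs with h1 h2
    · rw [h1, hab]
    · rw [h2, hab]
    · rfl
  have h := Equiv.sum_comp (Equiv.mulLeft (Equiv.swap a b))
    (fun σ : Equiv.Perm (Fin k) => ((Equiv.Perm.sign σ : ℤ) : F) * G (w ∘ σ))
  have h2 : ∀ σ : Equiv.Perm (Fin k), w ∘ ⇑(Equiv.swap a b * σ) = w ∘ σ := fun σ => by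
    rw [Equiv.Perm.coe_mul, ← Function.comp_assoc, hs]
  simp only [Equiv.coe_mulLeft, h2, Equiv.Perm.sign_mul, Equiv.Perm.sign_swap hne] at h
  simp only [neg_mul, one_mul, Units.val_neg, Int.cast_neg, Finset.sum_neg_distrib] at h
  exact self_eq_neg.1 h.symm

theorem prod_pairs_swap {F : Type*} [Field F] (k : ℕ) (w : Fin (k + 1) → F) (p : Fin (k + 1)) :
    ∏ i, ∏ j ∈ Finset.Ioi i, (w i - w j) = (if p = 0 then 1 else -1) *
      ((∏ j ∈ Finset.univ.erase p, (w p - w j)) *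
        ∏ i : Fin k, ∏ j ∈ Finset.Ioi i,
          (w (Equiv.swap 0 p i.succ) - w (Equiv.swap 0 p j.succ))) := by
  have h := (Equiv.swap 0 p).prod_Ioi_comp_eq_sign_mul_prod (f := fun i j => w i - w j)
    (by simp)
  rw [prod_pairs_succ] at h
  simp only [Equiv.swap_apply_left] at h
  rw [prod_swap_succ k p (fun j => w p - w j)] at h
  rw [h]
  by_cases hp : p = 0
  · simp [hp]
  · simp [hp, Equiv.Perm.sign_swap (Ne.symm hp)]

theorem antisymm_core {F : Type*} [Field F] [CharZero F] (q : F) (hq : q ≠ 0)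
    (k : ℕ) (w : Fin k → F) :
      ∑ σ : Equiv.Perm (Fin k), ((Equiv.Perm.sign σ : ℤ) : F) *
        ∏ i, ∏ j ∈ Finset.Ioi i, (q * w (σ i) - q⁻¹ * w (σ j)) =
    qFact q k * ∏ i, ∏ j ∈ Finset.Ioi i, (w i - w j) := by
  induction k with
  | zero => simp [qFact]
  | succ k ih =>
    by_cases hw : Function.Injective w
    swap
    · have := sum_noninj (k + 1) w hw
        (fun v => ∏ i, ∏ j ∈ Finset.Ioi i, (q * v i - q⁻¹ * v j))
      simp only [Function.comp] at this
      rw [this]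
      simp only [Function.Injective, not_forall] at hw
      obtain ⟨a, b, hab, hne⟩ := hw
      symm
      apply mul_eq_zero_of_right
      rcases lt_or_gt_of_ne hne with h | h
      · exact Finset.prod_eq_zero (Finset.mem_univ a)
          (Finset.prod_eq_zero (Finset.mem_Ioi.2 h) (by rw [hab, sub_self]))
      · exact Finset.prod_eq_zero (Finset.mem_univ b)
          (Finset.prod_eq_zero (Finset.mem_Ioi.2 h) (by rw [hab, sub_self]))
    have hfact : qFact q (k + 1) = qFact q k * qInt q (k + 1) := by
      rw [qFact, qFact, Finset.prod_Icc_succ_top (by omega)]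
    have hsum := sum_qInt q hq w Finset.univ Finset.univ_nonempty hw.injOn
    rw [Finset.card_univ, Fintype.card_fin] at hsum
    rw [← Equiv.sum_comp Equiv.Perm.decomposeFin.symm, Fintype.sum_prod_type, hfact, ← hsum,
      Finset.mul_sum, Finset.sum_mul]
    refine Finset.sum_congr rfl fun p _ => ?_
    have hih := ih (fun x => w (Equiv.swap 0 p x.succ))
    have hterm : ∀ e : Equiv.Perm (Fin k),
        ∏ x : Fin k, (q * w p - q⁻¹ * w (Equiv.swap 0 p (e x).succ)) =
          ∏ j ∈ Finset.univ.erase p, (q * w p - q⁻¹ * w j) := fun e => by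
      rw [Equiv.prod_comp e (fun x => q * w p - q⁻¹ * w (Equiv.swap 0 p x.succ)),
        prod_swap_succ k p (fun j => q * w p - q⁻¹ * w j)]
    have hne : ∏ j ∈ Finset.univ.erase p, (w p - w j) ≠ 0 := by
      rw [Finset.prod_ne_zero_iff]
      intro j hj
      exact sub_ne_zero.2 fun h => (Finset.ne_of_mem_erase hj) (hw h).symm
    rw [prod_pairs_swap k w p]
    simp only [prod_pairs_succ, Equiv.Perm.decomposeFin_symm_apply_zero,
      Equiv.Perm.decomposeFin_symm_apply_succ, hterm, Equiv.Perm.decomposeFin.symm_sign]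
    have hε : (((if p = 0 then (1 : ℤˣ) else -1 : ℤˣ) : ℤ) : F) = if p = 0 then 1 else -1 := by
      split_ifs <;> simp
    simp only [Units.val_mul, Int.cast_mul, hε]
    calc _ = (if p = 0 then (1 : F) else -1) *
          (∏ j ∈ Finset.univ.erase p, (q * w p - q⁻¹ * w j)) *
          (qFact q k * ∏ i : Fin k, ∏ j ∈ Finset.Ioi i,
            (w (Equiv.swap 0 p i.succ) - w (Equiv.swap 0 p j.succ))) := by
          rw [← hih, Finset.mul_sum]
          exact Finset.sum_congr rfl fun e _ => by ring
      _ = _ := by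
          generalize ∏ j ∈ Finset.univ.erase p, (w p - w j) = D at hne ⊢
          generalize ∏ j ∈ Finset.univ.erase p, (q * w p - q⁻¹ * w j) = N
          generalize (if p = 0 then (1 : F) else -1) = ε
          field_simp

/-- Antisymmetrization identity:
`(1/k!)·Σ_{σ∈S_k} sign(σ)·Π_{i<j} (q·w_{σ(i)} − q⁻¹·w_{σ(j)}) = ([k]!/k!)·Π_{i<j} (w_i − w_j)`. -/
theorem antisymmetrization {F : Type*} [Field F] [CharZero F] (q : F) (hq : q ≠ 0)
    (k : ℕ) (w : Fin k → F) :
    (k.factorial : F)⁻¹ *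
      ∑ σ : Equiv.Perm (Fin k), ((Equiv.Perm.sign σ : ℤ) : F) *
        ∏ p ∈ Finset.univ.filter (fun p : Fin k × Fin k => p.1 < p.2),
          (q * w (σ p.1) - q⁻¹ * w (σ p.2)) =
    qFact q k / (k.factorial : F) *
      ∏ p ∈ Finset.univ.filter (fun p : Fin k × Fin k => p.1 < p.2),
        (w p.1 - w p.2) := by
  have h := antisymm_core q hq k w
  rw [prod_pairs k (fun i j => w i - w j)]
  have h2 : ∀ σ : Equiv.Perm (Fin k),
      ∏ p ∈ Finset.univ.filter (fun p : Fin k × Fin k => p.1 < p.2),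
        (q * w (σ p.1) - q⁻¹ * w (σ p.2)) =
      ∏ i, ∏ j ∈ Finset.Ioi i, (q * w (σ i) - q⁻¹ * w (σ j)) := fun σ =>
    prod_pairs k (fun i j => q * w (σ i) - q⁻¹ * w (σ j))
  simp only [h2, h]
  ring
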